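/- Let A be a complex Banach algebra, let H_B ∈ A with ‖H_B‖ ≤ β, let H′ : [0,T] → A be continuous with ‖H′(t)‖ ≤ J for all t ∈ [0,T] (β, J ≥ 0, T ≥ 0), and set H(t) := H_B + H′(t). Then the third-order Magnus term Ω₃(T) := (i/6) ∫_0^T ds₁ ∫_0^{s₁} ds₂ ∫_0^{s₂} ds₃ ( [H(s₁),[H(s₂),H(s₃)]] + [H(s₃),[H(s₂),H(s₁)]] ) satisfies ‖Ω₃(T)‖ ≤ (2/(9√3)) (βT)²(JT) + (1/3)(βT)(JT)² + (2/9)(JT)³, and consequently ‖Ω₃(T)‖ ≤ (2/9) (εT)² (JT), where ε := β + J. -/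

import Mathlib

section IteratedIntegrals

variable {E : Type*} [NormedAddCommGroup E] [NormedSpace ℝ E]

theorem continuous_integral_zero_to_self {F : ℝ → ℝ → E}
    (hF : Continuous (Function.uncurry F)) :
    Continuous fun s => ∫ t in (0:ℝ)..s, F s t :=
  intervalIntegral.continuous_parametric_intervalIntegral_of_continuous hF continuous_id

theorem continuous_primitive_zero {G : ℝ → E} (hG : Continuous G) :
    Continuous fun s => ∫ t in (0:ℝ)..s, G t :=
  intervalIntegral.continuous_primitive (fun _ _ => hG.intervalIntegrable _ _) 0

theorem integral_smul_primitive [CompleteSpace E] {φ Φ : ℝ → ℝ} {G : ℝ → E}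
    (hφ : Continuous φ) (hΦ : ∀ x, HasDerivAt Φ (φ x) x) (hG : Continuous G) (a : ℝ) :
    ∫ s in (0:ℝ)..a, φ s • ∫ t in (0:ℝ)..s, G t = ∫ t in (0:ℝ)..a, (Φ a - Φ t) • G t := by
  have h := intervalIntegral.integral_smul_deriv_eq_deriv_smul
    (a := 0) (b := a) (u := fun t => Φ a - Φ t) (u' := fun t => -φ t)
    (v := fun s => ∫ t in (0:ℝ)..s, G t) (v' := G)
    (fun x _ => (hΦ x).const_sub _) (fun x _ => hG.integral_hasStrictDerivAt 0 x |>.hasDerivAt)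
    (hφ.neg.intervalIntegrable _ _) (hG.intervalIntegrable _ _)
  rw [h]
  simp

theorem integral_primitive [CompleteSpace E] {G : ℝ → E} (hG : Continuous G) (a : ℝ) :
    ∫ s in (0:ℝ)..a, ∫ t in (0:ℝ)..s, G t = ∫ t in (0:ℝ)..a, (a - t) • G t := by
  simpa using integral_smul_primitive (φ := fun _ => 1) (Φ := fun x => x) continuous_const
    (fun x => hasDerivAt_id x) hG a

/-- An integral over the ordered simplex of terms depending on two of the three variables reduces
to a double integral. -/
theorem integral_simplex_of_pairs [CompleteSpace E] {P R S : ℝ → ℝ → E} {C : ℝ → ℝ → ℝ → E}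
    (hP : Continuous (Function.uncurry P)) (hR : Continuous (Function.uncurry R))
    (hS : Continuous (Function.uncurry S))
    (hC : Continuous fun p : ℝ × ℝ × ℝ => C p.1 p.2.1 p.2.2) (T : ℝ) :
    ∫ a in (0:ℝ)..T, ∫ b in (0:ℝ)..a, ∫ c in (0:ℝ)..b, (P a b + R b c + S a c + C a b c) =
      (∫ s in (0:ℝ)..T, ∫ t in (0:ℝ)..s, (t • P s t + (T - s) • R s t + (s - t) • S s t)) +
        ∫ a in (0:ℝ)..T, ∫ b in (0:ℝ)..a, ∫ c in (0:ℝ)..b, C a b c := by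
  have hP' : ∀ a, Continuous (P a) := fun a => hP.comp (by fun_prop : Continuous fun b => (a, b))
  have hR' : ∀ a, Continuous (R a) := fun a => hR.comp (by fun_prop : Continuous fun b => (a, b))
  have hS' : ∀ a, Continuous (S a) := fun a => hS.comp (by fun_prop : Continuous fun b => (a, b))
  have hC' : ∀ a b, Continuous (C a b) := fun a b =>
    hC.comp (by fun_prop : Continuous fun c => (a, b, c))
  have hIR := continuous_integral_zero_to_self hR
  have hIC2 : Continuous (Function.uncurry fun a b => ∫ c in (0:ℝ)..b, C a b c) := by
    refine intervalIntegral.continuous_parametric_intervalIntegral_of_continuous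
      (f := fun (p : ℝ × ℝ) c => C p.1 p.2 c) (s := fun p => p.2) ?_ continuous_snd
    exact hC.comp (by fun_prop : Continuous fun q : (ℝ × ℝ) × ℝ => (q.1.1, q.1.2, q.2))
  have hIC3 := continuous_integral_zero_to_self hIC2
  have hIC' : ∀ a, Continuous fun b => ∫ c in (0:ℝ)..b, C a b c := fun a =>
    hIC2.comp (by fun_prop : Continuous fun b => (a, b))
  have htP : Continuous (Function.uncurry fun s t => t • P s t) := continuous_snd.smul hP
  have hsS : Continuous (Function.uncurry fun s t => (s - t) • S s t) :=
    (continuous_fst.sub continuous_snd).smul hS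
  have hIP := continuous_integral_zero_to_self htP
  have hIS := continuous_integral_zero_to_self hsS
  have inner : ∀ a b, ∫ c in (0:ℝ)..b, (P a b + R b c + S a c + C a b c) =
      b • P a b + (∫ c in (0:ℝ)..b, R b c) + (∫ c in (0:ℝ)..b, S a c)
        + ∫ c in (0:ℝ)..b, C a b c := by
    intro a b
    have := hR' b
    have := hS' a
    have := hC' a b
    rw [intervalIntegral.integral_add, intervalIntegral.integral_add,
      intervalIntegral.integral_add, intervalIntegral.integral_const, sub_zero]
    all_goals exact Continuous.intervalIntegrable (by fun_prop) _ _
  have middle : ∀ a, ∫ b in (0:ℝ)..a, (b • P a b + (∫ c in (0:ℝ)..b, R b c)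
        + (∫ c in (0:ℝ)..b, S a c) + ∫ c in (0:ℝ)..b, C a b c) =
      (∫ b in (0:ℝ)..a, b • P a b) + (∫ b in (0:ℝ)..a, ∫ c in (0:ℝ)..b, R b c)
        + (∫ b in (0:ℝ)..a, (a - b) • S a b)
        + ∫ b in (0:ℝ)..a, ∫ c in (0:ℝ)..b, C a b c := by
    intro a
    have := hP' a
    have := hIC' a
    have := continuous_primitive_zero (hS' a)
    rw [← integral_primitive (hS' a), intervalIntegral.integral_add,
      intervalIntegral.integral_add, intervalIntegral.integral_add]
    all_goals exact Continuous.intervalIntegrable (by fun_prop) _ _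
  have split : ∀ s, ∫ t in (0:ℝ)..s, (t • P s t + (T - s) • R s t + (s - t) • S s t) =
      (∫ t in (0:ℝ)..s, t • P s t) + (T - s) • (∫ t in (0:ℝ)..s, R s t)
        + ∫ t in (0:ℝ)..s, (s - t) • S s t := by
    intro s
    have := hP' s
    have := hR' s
    have := hS' s
    rw [intervalIntegral.integral_add, intervalIntegral.integral_add,
      intervalIntegral.integral_smul]
    all_goals exact Continuous.intervalIntegrable (by fun_prop) _ _
  have hIIR := continuous_primitive_zero hIR
  simp only [inner, middle, split]
  rw [intervalIntegral.integral_add, intervalIntegral.integral_add, intervalIntegral.integral_add,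
    intervalIntegral.integral_add, intervalIntegral.integral_add, integral_primitive hIR]
  all_goals exact Continuous.intervalIntegrable (by fun_prop) _ _

theorem norm_integral_triangle_le {F : ℝ → ℝ → E} {g : ℝ → ℝ → ℝ} {T : ℝ} (hT : 0 ≤ T)
    (hg : Continuous (Function.uncurry g)) (h : ∀ s t, 0 ≤ t → t ≤ s → s ≤ T → ‖F s t‖ ≤ g s t) :
    ‖∫ s in (0:ℝ)..T, ∫ t in (0:ℝ)..s, F s t‖ ≤ ∫ s in (0:ℝ)..T, ∫ t in (0:ℝ)..s, g s t := by
  refine intervalIntegral.norm_integral_le_of_norm_le hT (.of_forall fun s hs => ?_)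
    ((continuous_integral_zero_to_self hg).intervalIntegrable _ _)
  refine intervalIntegral.norm_integral_le_of_norm_le hs.1.le (.of_forall fun t ht => ?_)
    (Continuous.intervalIntegrable
      (hg.comp (by fun_prop : Continuous fun b => (s, b))) _ _)
  exact h s t ht.1.le ht.2 hs.2

theorem norm_integral_simplex_le {C : ℝ → ℝ → ℝ → E} {M T : ℝ} (hT : 0 ≤ T)
    (h : ∀ a b c, ‖C a b c‖ ≤ M) :
    ‖∫ a in (0:ℝ)..T, ∫ b in (0:ℝ)..a, ∫ c in (0:ℝ)..b, C a b c‖ ≤ M * (T ^ 3 / 6) := by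
  have key : ∀ a b : ℝ, 0 ≤ b → b ≤ a → a ≤ T → ‖∫ c in (0:ℝ)..b, C a b c‖ ≤ M * b := by
    intro a b hb _ _
    have := intervalIntegral.norm_integral_le_of_norm_le_const (a := 0) (b := b)
      (f := C a b) (C := M) (fun c _ => h a b c)
    rwa [sub_zero, abs_of_nonneg hb] at this
  have inner : ∀ s : ℝ, ∫ t in (0:ℝ)..s, M * t = M / 2 * s ^ 2 := fun s => by
    rw [intervalIntegral.integral_const_mul, integral_id]
    ring
  refine (norm_integral_triangle_le (g := fun _ b => M * b) hT (by fun_prop) key).trans_eq ?_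
  rw [intervalIntegral.integral_congr fun s _ => inner s, intervalIntegral.integral_const_mul,
    integral_pow]
  norm_num
  ring

end IteratedIntegrals

section Weights

theorem hasDerivAt_mul_abs (x : ℝ) : HasDerivAt (fun y : ℝ => y * |y| / 2) |x| x := by
  rcases lt_trichotomy x 0 with hx | rfl | hx
  · have h := (((hasDerivAt_id x).mul (hasDerivAt_abs hx.ne)).div_const 2)
    refine h.congr_deriv ?_
    simp [hx, abs_of_neg hx]
  · rw [hasDerivAt_iff_tendsto_slope_zero]
    have h : Filter.Tendsto (fun y : ℝ => |y| / 2) (nhdsWithin 0 {0}ᶜ) (nhds (|0| / 2)) :=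
      (Continuous.tendsto (by fun_prop) 0).mono_left nhdsWithin_le_nhds
    simp only [abs_zero, zero_div] at h ⊢
    refine h.congr' ?_
    filter_upwards [self_mem_nhdsWithin] with y hy
    have hy : y ≠ 0 := hy
    simp
    field_simp
  · have h := (((hasDerivAt_id x).mul (hasDerivAt_abs hx.ne')).div_const 2)
    refine h.congr_deriv ?_
    simp [hx, abs_of_pos hx]

theorem integral_abs (a b : ℝ) : ∫ x in a..b, |x| = b * |b| / 2 - a * |a| / 2 :=
  intervalIntegral.integral_eq_sub_of_hasDerivAt (fun x _ => hasDerivAt_mul_abs x)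
    (continuous_abs.intervalIntegrable _ _)

theorem integral_mul_abs_reflect (T : ℝ) :
    ∫ s in (0:ℝ)..T, (T - 2 * s) * |T - 2 * s| = 0 := by
  have h := intervalIntegral.integral_comp_sub_left (a := 0) (b := T)
    (fun s => (T - 2 * s) * |T - 2 * s|) T
  have h' : ∀ x : ℝ, (T - 2 * (T - x)) * |T - 2 * (T - x)| = -((T - 2 * x) * |T - 2 * x|) := by
    intro x
    rw [← abs_neg (T - 2 * x)]
    ring_nf
  simp only [h', intervalIntegral.integral_neg, sub_zero, sub_self] at h
  linarith

theorem integral_abs_quadratic_weights {T : ℝ} (hT : 0 ≤ T) :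
    ∫ s in (0:ℝ)..T, ∫ t in (0:ℝ)..s, (|T - s - t| + |2 * t - s| + |T - 2 * s + t|) =
      T ^ 3 / 2 := by
  have inner : ∀ s ∈ Set.uIcc 0 T,
      ∫ t in (0:ℝ)..s, (|T - s - t| + |2 * t - s| + |T - 2 * s + t|) =
        (T - s) ^ 2 + s ^ 2 / 2 - (T - 2 * s) * |T - 2 * s| := by
    intro s hs
    rw [Set.uIcc_of_le hT] at hs
    have h1 : ∫ t in (0:ℝ)..s, |T - s - t| =
        (T - s) ^ 2 / 2 - (T - 2 * s) * |T - 2 * s| / 2 := by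
      rw [intervalIntegral.integral_comp_sub_left (fun x => |x|), integral_abs, sub_zero,
        abs_of_nonneg (sub_nonneg.2 hs.2), show T - s - s = T - 2 * s by ring]
      ring
    have h2 : ∫ t in (0:ℝ)..s, |2 * t - s| = s ^ 2 / 2 := by
      rw [intervalIntegral.integral_comp_mul_sub (fun x => |x|) two_ne_zero, integral_abs,
        show 2 * s - s = s by ring, show 2 * 0 - s = -s by ring, abs_neg, abs_of_nonneg hs.1,
        smul_eq_mul]
      ring
    have h3 : ∫ t in (0:ℝ)..s, |T - 2 * s + t| =
        (T - s) ^ 2 / 2 - (T - 2 * s) * |T - 2 * s| / 2 := by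
      rw [intervalIntegral.integral_comp_add_left (fun x => |x|), integral_abs,
        show T - 2 * s + s = T - s by ring, add_zero, abs_of_nonneg (sub_nonneg.2 hs.2)]
      ring
    rw [intervalIntegral.integral_add, intervalIntegral.integral_add, h1, h2, h3]
    · ring
    all_goals exact Continuous.intervalIntegrable (by fun_prop) _ _
  have hd : ∀ x : ℝ, HasDerivAt (fun s : ℝ => -(T - s) ^ 3 / 3 + s ^ 3 / 6)
      ((T - x) ^ 2 + x ^ 2 / 2) x := by
    intro x
    have h := (((((hasDerivAt_id x).const_sub T).pow 3).neg).div_const 3).add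
      (((hasDerivAt_id x).pow 3).div_const 6)
    refine h.congr_deriv ?_
    simp
    ring
  rw [intervalIntegral.integral_congr inner, intervalIntegral.integral_sub,
    integral_mul_abs_reflect, intervalIntegral.integral_eq_sub_of_hasDerivAt (fun x _ => hd x)]
  · simp
    ring
  all_goals exact Continuous.intervalIntegrable (by fun_prop) _ _

theorem integral_abs_linear_weight {T : ℝ} (hT : 0 ≤ T) :
    ∫ s in (0:ℝ)..T, |s ^ 2 / 2 + (T - s) ^ 2 / 2 - 2 * ((T - s) * s)| =
      T ^ 3 / (3 * Real.sqrt 3) := by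
  obtain ⟨c, hc, hc0, hcT⟩ : ∃ c : ℝ, 12 * c ^ 2 = T ^ 2 ∧ 0 ≤ c ∧ c = T * Real.sqrt 3 / 6 := by
    refine ⟨T * Real.sqrt 3 / 6, ?_, by positivity, rfl⟩
    rw [div_pow, mul_pow, Real.sq_sqrt (by norm_num)]
    ring
  have hcle : c ≤ T / 2 := by nlinarith
  set w : ℝ → ℝ := fun s => s ^ 2 / 2 + (T - s) ^ 2 / 2 - 2 * ((T - s) * s) with hw
  have hwc : Continuous w := by fun_prop
  have hfac : ∀ s, w s = 3 * (s - (T / 2 - c)) * (s - (T / 2 + c)) := by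
    intro s
    simp only [hw]
    linear_combination (1 / 4 : ℝ) * hc
  have hd : ∀ x : ℝ, HasDerivAt (fun s : ℝ => s * (T - s) * (T - 2 * s) / 2) (w x) x := by
    intro x
    have h := (((hasDerivAt_id x).mul ((hasDerivAt_id x).const_sub T)).mul
      (((hasDerivAt_id x).const_mul 2).const_sub T)).div_const 2
    refine h.congr_deriv ?_
    simp [hw]
    ring
  have hint : ∀ a b, ∫ s in a..b, w s =
      b * (T - b) * (T - 2 * b) / 2 - a * (T - a) * (T - 2 * a) / 2 := fun a b =>
    intervalIntegral.integral_eq_sub_of_hasDerivAt (fun x _ => hd x) (hwc.intervalIntegrable _ _)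
  have h1 : ∫ s in (0:ℝ)..(T / 2 - c), |w s| = ∫ s in (0:ℝ)..(T / 2 - c), w s := by
    refine intervalIntegral.integral_congr fun s hs => ?_
    rw [Set.uIcc_of_le (by linarith)] at hs
    refine abs_of_nonneg ?_
    rw [hfac]
    nlinarith [mul_nonneg (sub_nonneg.2 hs.2) (by linarith [hs.2] : 0 ≤ T / 2 + c - s)]
  have h2 : ∫ s in (T / 2 - c)..(T / 2 + c), |w s| = ∫ s in (T / 2 - c)..(T / 2 + c), -w s := by
    refine intervalIntegral.integral_congr fun s hs => ?_
    rw [Set.uIcc_of_le (by linarith)] at hs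
    refine abs_of_nonpos ?_
    rw [hfac]
    nlinarith [mul_nonneg (sub_nonneg.2 hs.1) (sub_nonneg.2 hs.2)]
  have h3 : ∫ s in (T / 2 + c)..T, |w s| = ∫ s in (T / 2 + c)..T, w s := by
    refine intervalIntegral.integral_congr fun s hs => ?_
    rw [Set.uIcc_of_le (by linarith)] at hs
    refine abs_of_nonneg ?_
    rw [hfac]
    nlinarith [mul_nonneg (sub_nonneg.2 hs.1) (by linarith [hs.1] : 0 ≤ s - (T / 2 - c))]
  have hi : ∀ a b, IntervalIntegrable (fun s => |w s|) MeasureTheory.volume a b := fun a b =>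
    hwc.abs.intervalIntegrable _ _
  change ∫ s in (0:ℝ)..T, |w s| = _
  rw [← intervalIntegral.integral_add_adjacent_intervals (hi 0 (T / 2 + c)) (hi _ T),
    ← intervalIntegral.integral_add_adjacent_intervals (hi 0 (T / 2 - c)) (hi _ (T / 2 + c)),
    h1, h2, h3, intervalIntegral.integral_neg, hint, hint, hint]
  have h3' : Real.sqrt 3 ^ 2 = 3 := Real.sq_sqrt (by norm_num)
  have hs3 : 0 < Real.sqrt 3 := by positivity
  have : T ^ 3 / (3 * Real.sqrt 3) = 2 / 3 * T ^ 2 * c := by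
    rw [hcT]
    field_simp
    rw [h3']
    ring
  rw [this]
  linear_combination (-(1 / 3) * c) * hc

end Weights

theorem integral_linear_terms {E : Type*} [NormedAddCommGroup E] [NormedSpace ℝ E]
    [CompleteSpace E] {k : ℝ → E} (hk : Continuous k) (T : ℝ) :
    ∫ s in (0:ℝ)..T, ∫ t in (0:ℝ)..s, (t • (k s - (2:ℝ) • k t) + (T - s) • k t) =
      ∫ s in (0:ℝ)..T, (s ^ 2 / 2 + (T - s) ^ 2 / 2 - 2 * ((T - s) * s)) • k s := by
  have htk : Continuous fun t => t • k t := by fun_prop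
  have hd : ∀ x, HasDerivAt (fun s : ℝ => -(T - s) ^ 2 / 2) (T - x) x := by
    intro x
    have h := ((((hasDerivAt_id x).const_sub T).pow 2).neg).div_const 2
    refine h.congr_deriv ?_
    simp
  have inner : ∀ s, ∫ t in (0:ℝ)..s, (t • (k s - (2:ℝ) • k t) + (T - s) • k t) =
      (s ^ 2 / 2) • k s - (2:ℝ) • (∫ t in (0:ℝ)..s, t • k t)
        + (T - s) • ∫ t in (0:ℝ)..s, k t := by
    intro s
    simp only [smul_sub, smul_comm _ (2:ℝ)]
    rw [intervalIntegral.integral_add, intervalIntegral.integral_sub,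
      intervalIntegral.integral_smul_const, intervalIntegral.integral_smul,
      intervalIntegral.integral_smul, integral_id]
    · simp
    all_goals exact Continuous.intervalIntegrable (by fun_prop) _ _
  have hK := continuous_primitive_zero hk
  have hK' := continuous_primitive_zero htk
  simp only [inner]
  rw [intervalIntegral.integral_add, intervalIntegral.integral_sub, intervalIntegral.integral_smul,
    integral_primitive htk, integral_smul_primitive (by fun_prop) hd hk,
    ← intervalIntegral.integral_smul, ← intervalIntegral.integral_sub,
    ← intervalIntegral.integral_add]
  · congr 1
    ext s
    module
  all_goals exact Continuous.intervalIntegrable (by fun_prop) _ _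

theorem norm_lie_le_of_le {A : Type*} [NormedRing A] {x y : A} {a b : ℝ} (hx : ‖x‖ ≤ a)
    (hy : ‖y‖ ≤ b) : ‖⁅x, y⁆‖ ≤ 2 * a * b := by
  have ha : 0 ≤ a := (norm_nonneg x).trans hx
  have hxy : ‖x * y‖ ≤ a * b := norm_mul_le_of_le hx hy
  have hyx : ‖y * x‖ ≤ b * a := norm_mul_le_of_le hy hx
  rw [Ring.lie_def]
  linarith [norm_sub_le (x * y) (y * x)]

theorem magnus_third_order_integrand {A : Type*} [Ring A] (B x y z : A) :
    ((B + x) * ((B + y) * (B + z) - (B + z) * (B + y))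
        - ((B + y) * (B + z) - (B + z) * (B + y)) * (B + x))
      + ((B + z) * ((B + y) * (B + x) - (B + x) * (B + y))
        - ((B + y) * (B + x) - (B + x) * (B + y)) * (B + z)) =
    (⁅B, ⁅B, x⁆⁆ - (⁅B, ⁅B, y⁆⁆ + ⁅B, ⁅B, y⁆⁆) + (⁅x, ⁅y, B⁆⁆ - ⁅B, ⁅x, y⁆⁆))
      + (⁅B, ⁅B, z⁆⁆ + (⁅B, ⁅y, z⁆⁆ + ⁅z, ⁅y, B⁆⁆))
      + (-⁅x, ⁅z, B⁆⁆ - ⁅z, ⁅x, B⁆⁆)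
      + (⁅x, ⁅y, z⁆⁆ + ⁅z, ⁅y, x⁆⁆) := by
  simp only [Ring.lie_def]
  noncomm_ring

theorem norm_magnus_third_order_integral_le {A : Type*} [NormedRing A] [NormedAlgebra ℝ A]
    [CompleteSpace A] {T β J : ℝ} (hT : 0 ≤ T) {B : A} (hB : ‖B‖ ≤ β) {h : ℝ → A}
    (hc : Continuous h) (hh : ∀ t, ‖h t‖ ≤ J) :
    ‖∫ s₁ in (0:ℝ)..T, ∫ s₂ in (0:ℝ)..s₁, ∫ s₃ in (0:ℝ)..s₂,
        (((B + h s₁) * ((B + h s₂) * (B + h s₃) - (B + h s₃) * (B + h s₂))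
            - ((B + h s₂) * (B + h s₃) - (B + h s₃) * (B + h s₂)) * (B + h s₁))
          + ((B + h s₃) * ((B + h s₂) * (B + h s₁) - (B + h s₁) * (B + h s₂))
            - ((B + h s₂) * (B + h s₁) - (B + h s₁) * (B + h s₂)) * (B + h s₃)))‖
      ≤ 4 * β ^ 2 * J * (T ^ 3 / (3 * Real.sqrt 3)) + 4 * β * J ^ 2 * (T ^ 3 / 2)
        + 8 * J ^ 3 * (T ^ 3 / 6) := by
  simp only [magnus_third_order_integrand]
  rw [integral_simplex_of_pairs
    (P := fun s t => ⁅B, ⁅B, h s⁆⁆ - (⁅B, ⁅B, h t⁆⁆ + ⁅B, ⁅B, h t⁆⁆)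
      + (⁅h s, ⁅h t, B⁆⁆ - ⁅B, ⁅h s, h t⁆⁆))
    (R := fun s t => ⁅B, ⁅B, h t⁆⁆ + (⁅B, ⁅h s, h t⁆⁆ + ⁅h t, ⁅h s, B⁆⁆))
    (S := fun s t => -⁅h s, ⁅h t, B⁆⁆ - ⁅h t, ⁅h s, B⁆⁆)
    (C := fun a b c => ⁅h a, ⁅h b, h c⁆⁆ + ⁅h c, ⁅h b, h a⁆⁆)
    (by simp only [Ring.lie_def]; fun_prop) (by simp only [Ring.lie_def]; fun_prop)
    (by simp only [Ring.lie_def]; fun_prop) (by simp only [Ring.lie_def]; fun_prop)]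
  have hk : Continuous fun s => ⁅B, ⁅B, h s⁆⁆ := by
    simp only [Ring.lie_def]
    fun_prop
  set Q : ℝ → ℝ → A := fun s t => (T - s - t) • ⁅B, ⁅h s, h t⁆⁆ + (2 * t - s) • ⁅h s, ⁅h t, B⁆⁆
    + (T - 2 * s + t) • ⁅h t, ⁅h s, B⁆⁆ with hQ
  set L : ℝ → ℝ → A := fun s t =>
    t • (⁅B, ⁅B, h s⁆⁆ - (2:ℝ) • ⁅B, ⁅B, h t⁆⁆) + (T - s) • ⁅B, ⁅B, h t⁆⁆ with hL
  have hQc : Continuous (Function.uncurry Q) := by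
    simp only [hQ, Ring.lie_def]
    fun_prop
  have hLc : Continuous (Function.uncurry L) := by
    simp only [hL, Ring.lie_def]
    fun_prop
  have hsplit : ∀ s t, t • (⁅B, ⁅B, h s⁆⁆ - (⁅B, ⁅B, h t⁆⁆ + ⁅B, ⁅B, h t⁆⁆)
        + (⁅h s, ⁅h t, B⁆⁆ - ⁅B, ⁅h s, h t⁆⁆))
      + (T - s) • (⁅B, ⁅B, h t⁆⁆ + (⁅B, ⁅h s, h t⁆⁆ + ⁅h t, ⁅h s, B⁆⁆))
      + (s - t) • (-⁅h s, ⁅h t, B⁆⁆ - ⁅h t, ⁅h s, B⁆⁆) = L s t + Q s t := by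
    intro s t
    simp only [hL, hQ]
    module
  have hLQ : ∫ s in (0:ℝ)..T, ∫ t in (0:ℝ)..s, (L s t + Q s t) =
      (∫ s in (0:ℝ)..T, ∫ t in (0:ℝ)..s, L s t) + ∫ s in (0:ℝ)..T, ∫ t in (0:ℝ)..s, Q s t := by
    rw [← intervalIntegral.integral_add
      ((continuous_integral_zero_to_self hLc).intervalIntegrable _ _)
      ((continuous_integral_zero_to_self hQc).intervalIntegrable _ _)]
    congr 1
    ext s
    exact intervalIntegral.integral_add
      ((hLc.comp (by fun_prop : Continuous fun t => (s, t))).intervalIntegrable _ _)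
      ((hQc.comp (by fun_prop : Continuous fun t => (s, t))).intervalIntegrable _ _)
  simp only [hsplit]
  rw [hLQ]
  have hLn : ‖∫ s in (0:ℝ)..T, ∫ t in (0:ℝ)..s, L s t‖ ≤
      4 * β ^ 2 * J * (T ^ 3 / (3 * Real.sqrt 3)) := by
    rw [hL, integral_linear_terms hk, ← integral_abs_linear_weight hT,
      ← intervalIntegral.integral_const_mul]
    refine intervalIntegral.norm_integral_le_of_norm_le hT (.of_forall fun s _ => ?_)
      (Continuous.intervalIntegrable (by fun_prop) _ _)
    rw [norm_smul, Real.norm_eq_abs, mul_comm]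
    refine mul_le_mul_of_nonneg_right ?_ (abs_nonneg _)
    exact (norm_lie_le_of_le hB (norm_lie_le_of_le hB (hh s))).trans_eq (by ring)
  have hQn : ‖∫ s in (0:ℝ)..T, ∫ t in (0:ℝ)..s, Q s t‖ ≤ 4 * β * J ^ 2 * (T ^ 3 / 2) := by
    rw [← integral_abs_quadratic_weights hT, ← intervalIntegral.integral_const_mul]
    simp only [← intervalIntegral.integral_const_mul]
    refine norm_integral_triangle_le hT (by fun_prop) fun s t _ _ _ => ?_
    have n1 : ‖⁅B, ⁅h s, h t⁆⁆‖ ≤ 4 * β * J ^ 2 :=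
      (norm_lie_le_of_le hB (norm_lie_le_of_le (hh s) (hh t))).trans_eq (by ring)
    have n2 : ‖⁅h s, ⁅h t, B⁆⁆‖ ≤ 4 * β * J ^ 2 :=
      (norm_lie_le_of_le (hh s) (norm_lie_le_of_le (hh t) hB)).trans_eq (by ring)
    have n3 : ‖⁅h t, ⁅h s, B⁆⁆‖ ≤ 4 * β * J ^ 2 :=
      (norm_lie_le_of_le (hh t) (norm_lie_le_of_le (hh s) hB)).trans_eq (by ring)
    refine norm_add₃_le.trans ?_
    simp only [norm_smul, Real.norm_eq_abs]
    calc _ ≤ |T - s - t| * (4 * β * J ^ 2) + |2 * t - s| * (4 * β * J ^ 2)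
          + |T - 2 * s + t| * (4 * β * J ^ 2) := by gcongr
      _ = _ := by ring
  have hCn := norm_integral_simplex_le (C := fun a b c => ⁅h a, ⁅h b, h c⁆⁆ + ⁅h c, ⁅h b, h a⁆⁆)
    (M := 8 * J ^ 3) hT fun a b c => by
      have n1 := norm_lie_le_of_le (hh a) (norm_lie_le_of_le (hh b) (hh c))
      have n2 := norm_lie_le_of_le (hh c) (norm_lie_le_of_le (hh b) (hh a))
      exact (norm_add_le_of_le n1 n2).trans_eq (by ring)
  exact norm_add_le_of_le (norm_add_le_of_le hLn hQn) hCn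


/-- Bound on the third-order Magnus term.  With `H t = H_B + H' t`, `‖H_B‖ ≤ β`,
`‖H' t‖ ≤ J` on `[0,T]`, the term
`Ω₃(T) = (i/6) ∫_0^T ∫_0^{s₁} ∫_0^{s₂} ([H(s₁),[H(s₂),H(s₃)]] + [H(s₃),[H(s₂),H(s₁)]])`
satisfies `‖Ω₃(T)‖ ≤ (2/(9√3))(βT)²(JT) + (1/3)(βT)(JT)² + (2/9)(JT)³`, and consequently
`‖Ω₃(T)‖ ≤ (2/9)(εT)²(JT)` with `ε = β + J`. -/
theorem magnus_third_order_bound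
    {A : Type*} [NormedRing A] [NormedAlgebra ℂ A] [CompleteSpace A]
    (T β J : ℝ) (hT : 0 ≤ T) (hβ : 0 ≤ β) (hJ : 0 ≤ J)
    (H_B : A) (hHB : ‖H_B‖ ≤ β)
    (H' : ℝ → A) (hcont : ContinuousOn H' (Set.Icc 0 T))
    (hbound : ∀ t ∈ Set.Icc (0:ℝ) T, ‖H' t‖ ≤ J)
    (H : ℝ → A) (hH : ∀ t, H t = H_B + H' t) :
    ‖(Complex.I / 6) • ∫ s₁ in (0:ℝ)..T, ∫ s₂ in (0:ℝ)..s₁, ∫ s₃ in (0:ℝ)..s₂,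
        ((H s₁ * (H s₂ * H s₃ - H s₃ * H s₂) - (H s₂ * H s₃ - H s₃ * H s₂) * H s₁)
          + (H s₃ * (H s₂ * H s₁ - H s₁ * H s₂) - (H s₂ * H s₁ - H s₁ * H s₂) * H s₃))‖
      ≤ (2 / (9 * Real.sqrt 3)) * (β*T)^2 * (J*T)
          + (1/3) * (β*T) * (J*T)^2 + (2/9) * (J*T)^3 ∧
    ‖(Complex.I / 6) • ∫ s₁ in (0:ℝ)..T, ∫ s₂ in (0:ℝ)..s₁, ∫ s₃ in (0:ℝ)..s₂,
        ((H s₁ * (H s₂ * H s₃ - H s₃ * H s₂) - (H s₂ * H s₃ - H s₃ * H s₂) * H s₁)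
          + (H s₃ * (H s₂ * H s₁ - H s₁ * H s₂) - (H s₂ * H s₁ - H s₁ * H s₂) * H s₃))‖
      ≤ (2/9) * ((β + J) * T)^2 * (J*T) := by
  set h : ℝ → A := Set.IccExtend hT (Set.domRestrict (Set.Icc 0 T) H') with hdef
  have hc : Continuous h := Continuous.Icc_extend' hcont.domRestrict
  have hh : ∀ t, ‖h t‖ ≤ J := fun t => hbound _ (Set.projIcc 0 T hT t).2
  have hHh : ∀ t, 0 ≤ t → t ≤ T → H t = H_B + h t := fun t h0 h1 => by
    rw [hH, hdef, Set.IccExtend_of_mem hT _ ⟨h0, h1⟩]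
    rfl
  have first : ‖(Complex.I / 6) • ∫ s₁ in (0:ℝ)..T, ∫ s₂ in (0:ℝ)..s₁, ∫ s₃ in (0:ℝ)..s₂,
        ((H s₁ * (H s₂ * H s₃ - H s₃ * H s₂) - (H s₂ * H s₃ - H s₃ * H s₂) * H s₁)
          + (H s₃ * (H s₂ * H s₁ - H s₁ * H s₂) - (H s₂ * H s₁ - H s₁ * H s₂) * H s₃))‖
      ≤ (2 / (9 * Real.sqrt 3)) * (β*T)^2 * (J*T)
          + (1/3) * (β*T) * (J*T)^2 + (2/9) * (J*T)^3 := by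
    have key := norm_magnus_third_order_integral_le hT hHB hc hh
    rw [intervalIntegral.integral_congr (g := fun s₁ => ∫ s₂ in (0:ℝ)..s₁, ∫ s₃ in (0:ℝ)..s₂,
        (((H_B + h s₁) * ((H_B + h s₂) * (H_B + h s₃) - (H_B + h s₃) * (H_B + h s₂))
            - ((H_B + h s₂) * (H_B + h s₃) - (H_B + h s₃) * (H_B + h s₂)) * (H_B + h s₁))
          + ((H_B + h s₃) * ((H_B + h s₂) * (H_B + h s₁) - (H_B + h s₁) * (H_B + h s₂))
            - ((H_B + h s₂) * (H_B + h s₁) - (H_B + h s₁) * (H_B + h s₂)) * (H_B + h s₃)))),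
      norm_smul]
    · have hI : ‖Complex.I / 6‖ = 1 / 6 := by simp
      rw [hI]
      calc _ ≤ 1 / 6 * _ := mul_le_mul_of_nonneg_left key (by norm_num)
        _ = _ := by
          field_simp
          ring
    · intro s₁ h₁
      rw [Set.uIcc_of_le hT] at h₁
      refine intervalIntegral.integral_congr fun s₂ h₂ => ?_
      rw [Set.uIcc_of_le h₁.1] at h₂
      refine intervalIntegral.integral_congr fun s₃ h₃ => ?_
      rw [Set.uIcc_of_le h₂.1] at h₃
      simp only [hHh s₁ h₁.1 h₁.2, hHh s₂ h₂.1 (h₂.2.trans h₁.2),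
        hHh s₃ h₃.1 (h₃.2.trans (h₂.2.trans h₁.2))]
  refine ⟨first, first.trans ?_⟩
  have hsqrt : 2 / (9 * Real.sqrt 3) ≤ 2 / 9 := by
    have : (1:ℝ) ≤ Real.sqrt 3 := Real.one_le_sqrt.2 (by norm_num)
    gcongr
    linarith
  have hb : 0 ≤ β * T := by positivity
  have hj : 0 ≤ J * T := by positivity
  calc _ ≤ 2 / 9 * (β * T) ^ 2 * (J * T) + 4 / 9 * (β * T) * (J * T) ^ 2
        + 2 / 9 * (J * T) ^ 3 := by
        gcongr ?_ * _ * _ + ?_ * _ * _ + _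
        norm_num
    _ = _ := by ring
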